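/- An element ξ = (ξ_0,…,ξ_m) ∈ q⟨m⟩* is regular (i.e., dim q⟨m⟩_ξ = ind q⟨m⟩) if and only if its top component ξ_m ∈ q* is regular (dim q_{ξ_m} = ind q). In particular, if the non-regular locus of q* has codimension ≥ n, then so does the non-regular locus of q⟨m⟩*. -/

import Mathlib

open Module

variable (k : Type*) [Field k]

/-- The Takiff bracket on `q⟨m⟩ = q ⊗ k[T]/(T^{m+1})`, as a bilinear map. -/
noncomputable def takiffBracketL (L : Type*) [LieRing L] [LieAlgebra k L] (m : ℕ) :
    (Fin (m + 1) → L) →ₗ[k] (Fin (m + 1) → L) →ₗ[k] (Fin (m + 1) → L) :=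
  LinearMap.mk₂ k
    (fun x y l => ∑ i : Fin (m + 1), ∑ j : Fin (m + 1),
      if (i : ℕ) + (j : ℕ) = (l : ℕ) then ⁅x i, y j⁆ else 0)
    (by intro x x' y; funext l
        simp only [Pi.add_apply, add_lie, ← Finset.sum_add_distrib, ite_add_ite, add_zero])
    (by intro c x y; funext l
        simp only [Pi.smul_apply, smul_lie, Finset.smul_sum, smul_ite, smul_zero])
    (by intro x y y'; funext l
        simp only [Pi.add_apply, lie_add, ← Finset.sum_add_distrib, ite_add_ite, add_zero])
    (by intro c x y; funext l
        simp only [Pi.smul_apply, lie_smul, Finset.smul_sum, smul_ite, smul_zero])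

/-- The coadjoint stabiliser of `ξ ∈ q⟨m⟩*`. -/
noncomputable def takiffStab {L : Type*} [LieRing L] [LieAlgebra k L] (m : ℕ)
    (ξ : Module.Dual k (Fin (m + 1) → L)) : Submodule k (Fin (m + 1) → L) :=
  LinearMap.ker ((takiffBracketL k L m).compr₂ ξ)

/-- The index of the Takiff algebra `q⟨m⟩`. -/
noncomputable def takiffIndex (L : Type*) [LieRing L] [LieAlgebra k L] (m : ℕ) : ℕ :=
  sInf {d : ℕ | ∃ ξ : Module.Dual k (Fin (m + 1) → L),
    d = Module.finrank k (takiffStab k m ξ)}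

/-- The coadjoint stabiliser `q_ξ`. -/
noncomputable def coadStab {L : Type*} [LieRing L] [LieAlgebra k L]
    (ξ : Module.Dual k L) : Submodule k L where
  carrier := {x : L | ∀ y : L, ξ ⁅x, y⁆ = 0}
  add_mem' := by intro a b ha hb y; simp [add_lie, ha y, hb y]
  zero_mem' := by intro y; simp
  smul_mem' := by intro c a ha y; simp [smul_lie, ha y]

/-- The index of `q`. -/
noncomputable def lieIndex (L : Type*) [LieRing L] [LieAlgebra k L] : ℕ :=
  sInf {d : ℕ | ∃ ξ : Module.Dual k L, d = Module.finrank k (coadStab k ξ)}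

/-- Assemble a tuple `(ξ_0,…,ξ_m)` into an element of `q⟨m⟩*`. -/
noncomputable def assembleDual {L : Type*} [LieRing L] [LieAlgebra k L] (m : ℕ)
    (ξ : Fin (m + 1) → Module.Dual k L) : Module.Dual k (Fin (m + 1) → L) :=
  ∑ j : Fin (m + 1), (ξ j).comp (LinearMap.proj j)

open Polynomial in
/-- A polynomial matrix over an infinite field has a specialisation whose kernel is at most as
large as the kernel of the matrix itself. -/
theorem Polynomial.exists_finrank_ker_map_eval_le {K ι : Type*} [Field K] [Infinite K]
    [Fintype ι] (P : Matrix ι ι K[X]) :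
    ∃ t : K, finrank K (LinearMap.ker (P.map (eval t)).mulVecLin) ≤
      finrank K[X] (LinearMap.ker P.mulVecLin) := by
  obtain ⟨n, bM, bN, f, a, hsnf⟩ :=
    (LinearMap.range P.mulVecLin).smithNormalForm (Pi.basisFun K[X] ι)
  have ha : ∀ i, a i ≠ 0 := fun i hi => bN.ne_zero i (Subtype.ext (by simp [hsnf, hi]))
  obtain ⟨t, ht⟩ : ∃ t : K, eval t (∏ i, a i) ≠ 0 := by
    by_contra! h
    exact Finset.prod_ne_zero_iff.2 (fun i _ => ha i) (Polynomial.funext (by simpa using h))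
  rw [eval_prod, Finset.prod_ne_zero_iff] at ht
  refine ⟨t, ?_⟩
  have hbM : LinearIndependent K fun j l => eval t (bM j l) := by
    refine linearIndependent_of_top_le_span_of_card_eq_finrank (fun v _ => ?_) (by simp)
    have hv : v = ∑ j, eval t (bM.repr (fun l => C (v l)) j) • fun l => eval t (bM j l) := by
      ext l
      have h := congrArg (eval t) (congrFun (bM.sum_repr fun l => C (v l)) l)
      simpa [eval_finsetSum] using h.symm
    rw [hv]
    exact Submodule.sum_mem _ fun j _ =>
      Submodule.smul_mem _ _ (Submodule.subset_span (Set.mem_range_self j))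
  have hmem : ∀ i, (fun l => eval t (bM (f i) l)) ∈
      LinearMap.range (P.map (eval t)).mulVecLin := by
    intro i
    obtain ⟨u, hu⟩ := (bN i).2
    refine ⟨(eval t (a i))⁻¹ • fun l => eval t (u l), ?_⟩
    rw [map_smul, inv_smul_eq_iff₀ (ht i (Finset.mem_univ i))]
    ext l
    have h := congrArg (eval t) (congrFun (hu.trans (hsnf i)) l)
    simpa [Matrix.mulVec, dotProduct, eval_finsetSum] using h
  have hle : n ≤ finrank K (LinearMap.range (P.map (eval t)).mulVecLin) := by
    have h := finrank_span_eq_card (hbM.comp f f.injective)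
    rw [Fintype.card_fin] at h
    rw [← h]
    refine Submodule.finrank_mono (Submodule.span_le.2 ?_)
    rintro _ ⟨i, rfl⟩
    exact hmem i
  have h₁ := LinearMap.finrank_range_add_finrank_ker (P.map (eval t)).mulVecLin
  have h₂ := (LinearMap.ker P.mulVecLin).finrank_quotient_add_finrank
  rw [P.mulVecLin.quotKerEquivRange.finrank_eq, finrank_eq_card_basis bN] at h₂
  simp only [finrank_fintype_fun_eq_card, Fintype.card_fin] at h₁ h₂
  omega

/-- A basis of the kernel of a map between torsion-free modules over a principal ideal domain
can be chosen inside a basis of the source. -/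
theorem LinearMap.exists_basis_embedding_ker {R M N ι : Type*} [CommRing R] [IsDomain R]
    [IsPrincipalIdealRing R] [AddCommGroup M] [Module R M] [AddCommGroup N] [Module R N]
    [IsTorsionFree R N] [Finite ι] (b : Basis ι R M) (g : M →ₗ[R] N) :
    ∃ (c : Basis ι R M) (f : Fin (finrank R (LinearMap.ker g)) ↪ ι), ∀ i, g (c (f i)) = 0 := by
  obtain ⟨n, bM, bN, f, a, hsnf⟩ := (LinearMap.ker g).smithNormalForm b
  have hn : finrank R (LinearMap.ker g) = n := by simp [finrank_eq_card_basis bN]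
  refine ⟨bM, (finCongr hn).toEmbedding.trans f, fun i => ?_⟩
  have ha : a (finCongr hn i) ≠ 0 := fun hi =>
    bN.ne_zero (finCongr hn i) (Subtype.ext (by rw [hsnf, hi, zero_smul, Submodule.coe_zero]))
  have h : g (bN (finCongr hn i)) = 0 := (bN (finCongr hn i)).2
  rw [hsnf, map_smul] at h
  exact (smul_eq_zero.1 h).resolve_left ha

/-- If `r` divides every coordinate of a vector, it divides its coordinates in any basis. -/
theorem Module.Basis.dvd_repr_of_forall_dvd {R ι κ : Type*} [CommRing R] (c : Basis κ R (ι → R))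
    {r : R} {v : ι → R} (hv : ∀ l, r ∣ v l) (j : κ) : r ∣ c.repr v j := by
  choose w hw using hv
  obtain rfl : v = r • w := funext hw
  simp

section Takiff

variable {k : Type*} [Field k] {L : Type*} [LieRing L] [LieAlgebra k L] {m : ℕ}

theorem assembleDual_takiffBracketL (ξ : Fin (m + 1) → Dual k L) (x y : Fin (m + 1) → L) :
    assembleDual k m ξ (takiffBracketL k L m x y) =
      ∑ j : Fin (m + 1), ∑ i : Fin (m + 1), ∑ l : Fin (m + 1),
        if (i : ℕ) + (j : ℕ) = (l : ℕ) then ξ l ⁅x i, y j⁆ else 0 := by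
  simp only [assembleDual, takiffBracketL, LinearMap.sum_apply, LinearMap.comp_apply,
    LinearMap.proj_apply, LinearMap.mk₂_apply, map_sum, apply_ite (ξ _), map_zero]
  rw [Finset.sum_comm]
  exact (Finset.sum_congr rfl fun i _ => Finset.sum_comm).trans Finset.sum_comm

theorem mem_takiffStab_assembleDual {ξ : Fin (m + 1) → Dual k L} {x : Fin (m + 1) → L} :
    x ∈ takiffStab k m (assembleDual k m ξ) ↔ ∀ (j : Fin (m + 1)) (y : L),
      (∑ i : Fin (m + 1), ∑ l : Fin (m + 1),
        if (i : ℕ) + (j : ℕ) = (l : ℕ) then ξ l ⁅x i, y⁆ else 0) = 0 := by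
  constructor
  · intro hx j y
    have h : assembleDual k m ξ (takiffBracketL k L m x (Pi.single j y)) = 0 :=
      LinearMap.congr_fun (LinearMap.mem_ker.1 hx) (Pi.single j y)
    rw [assembleDual_takiffBracketL, Finset.sum_eq_single j] at h
    · simpa using h
    · intro j' _ hj'
      simp [Pi.single_eq_of_ne hj']
    · simp
  · intro hx
    refine LinearMap.mem_ker.2 (LinearMap.ext fun y => ?_)
    exact (assembleDual_takiffBracketL ξ x y).trans (Finset.sum_eq_zero fun j _ => hx j (y j))

theorem exists_assembleDual_eq (η : Dual k (Fin (m + 1) → L)) :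
    ∃ ξ : Fin (m + 1) → Dual k L, assembleDual k m ξ = η := by
  refine ⟨fun j => η.comp (LinearMap.single k (fun _ => L) j), LinearMap.ext fun x => ?_⟩
  simp only [assembleDual, LinearMap.sum_apply, LinearMap.comp_apply, LinearMap.proj_apply,
    LinearMap.single_apply, ← map_sum]
  rw [Finset.univ_sum_single]

/-- The lowest nonzero component of an element of the stabiliser of `ξ` stabilises `ξ_m`. -/
theorem apply_mem_coadStab_of_mem_takiffStab {ξ : Fin (m + 1) → Dual k L} {x : Fin (m + 1) → L}
    (hx : x ∈ takiffStab k m (assembleDual k m ξ)) (i : Fin (m + 1)) (hi : ∀ i' < i, x i' = 0) :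
    x i ∈ coadStab k (ξ (Fin.last m)) := by
  intro y
  have h := mem_takiffStab_assembleDual.1 hx i.rev y
  rw [Finset.sum_eq_single i, Finset.sum_eq_single (Fin.last m)] at h
  · rwa [if_pos (by simp only [Fin.val_rev, Fin.val_last]; omega)] at h
  · intro l _ hl
    refine if_neg fun h' => hl (Fin.ext ?_)
    simp only [Fin.val_rev, Fin.val_last] at h' ⊢
    omega
  · simp
  · intro i' _ hi'
    rcases lt_or_gt_of_ne hi' with h' | h'
    · simp [hi i' h']
    · refine Finset.sum_eq_zero fun l _ => if_neg ?_
      simp only [Fin.val_rev]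
      have := Fin.lt_def.1 h'
      omega
  · simp

theorem finrank_takiffStab_le [FiniteDimensional k L] (ξ : Fin (m + 1) → Dual k L) :
    finrank k (takiffStab k m (assembleDual k m ξ)) ≤
      (m + 1) * finrank k (coadStab k (ξ (Fin.last m))) := by
  obtain ⟨π, hπ⟩ := (coadStab k (ξ (Fin.last m))).subtype.exists_leftInverse_of_injective
    (Submodule.ker_subtype _)
  have hinj : Function.Injective
      ((LinearMap.compLeft π (Fin (m + 1))).domRestrict
        (takiffStab k m (assembleDual k m ξ))) := by
    rw [← LinearMap.ker_eq_bot, LinearMap.ker_eq_bot']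
    rintro ⟨x, hx⟩ h
    have hx0 : ∀ n (hn : n < m + 1), x ⟨n, hn⟩ = 0 := by
      intro n
      induction n using Nat.strong_induction_on with
      | _ n ih =>
        intro hn
        have hmem := apply_mem_coadStab_of_mem_takiffStab hx ⟨n, hn⟩ fun i' hi' => ih i' hi' _
        have h₁ : π (x ⟨n, hn⟩) = 0 := congrFun h ⟨n, hn⟩
        have h₂ := LinearMap.congr_fun hπ ⟨x ⟨n, hn⟩, hmem⟩
        exact congrArg Subtype.val (h₂.symm.trans h₁)
    exact Subtype.ext (funext fun i => hx0 i i.2)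
  simpa [finrank_pi_fintype] using LinearMap.finrank_le_finrank_of_injective hinj

theorem single_last_mem_takiffStab {ξ : Fin (m + 1) → Dual k L} {v : L}
    (hv : v ∈ coadStab k (ξ (Fin.last m))) :
    Pi.single (Fin.last m) v ∈ takiffStab k m (assembleDual k m ξ) := by
  refine mem_takiffStab_assembleDual.2 fun j y => ?_
  refine Finset.sum_eq_zero fun i _ => Finset.sum_eq_zero fun l _ => ?_
  split_ifs with h
  · rcases eq_or_ne i (Fin.last m) with rfl | hi
    · obtain rfl : l = Fin.last m := Fin.ext (by simp only [Fin.val_last] at h ⊢; omega)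
      simpa using hv y
    · simp [Pi.single_eq_of_ne hi]
  · rfl

theorem lieIndex_le_finrank_coadStab (η : Dual k L) :
    lieIndex k L ≤ finrank k (coadStab k η) :=
  Nat.sInf_le ⟨η, rfl⟩

theorem exists_finrank_coadStab_eq_lieIndex :
    ∃ η : Dual k L, finrank k (coadStab k η) = lieIndex k L :=
  (Nat.sInf_mem (s := {d | ∃ η : Dual k L, d = finrank k (coadStab k η)}) ⟨_, 0, rfl⟩).imp
    fun _ h => h.symm

open Polynomial

/-- The matrix, in the basis `b`, of the form on `L` attached to the polynomial curve
`∑ l, X ^ (m - l) • ξ l` of linear forms. -/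
noncomputable def takiffPolyMatrix {ι : Type*} (b : Basis ι k L) (ξ : Fin (m + 1) → Dual k L) :
    Matrix ι ι k[X] :=
  Matrix.of fun a c => ∑ l : Fin (m + 1), C (ξ l ⁅b c, b a⁆) * X ^ (m - (l : ℕ))

/-- The element of the Takiff algebra with coordinates `u`, truncated modulo `X ^ (m + 1)`. -/
noncomputable def takiffTrunc {ι : Type*} [Fintype ι] (b : Basis ι k L) (m : ℕ) :
    (ι → k[X]) →ₗ[k] (Fin (m + 1) → L) where
  toFun u i := ∑ c, (u c).coeff i • b c
  map_add' u v := by ext i; simp [add_smul, Finset.sum_add_distrib]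
  map_smul' r u := by ext i; simp [Finset.smul_sum, mul_smul]

variable {ι : Type*} [Fintype ι]

theorem takiffTrunc_mem_takiffStab (b : Basis ι k L) (ξ : Fin (m + 1) → Dual k L)
    {u : ι → k[X]} (hu : (takiffPolyMatrix b ξ).mulVecLin u = 0) :
    takiffTrunc b m u ∈ takiffStab k m (assembleDual k m ξ) := by
  have hb : ∀ (j : Fin (m + 1)) (a : ι), (∑ i : Fin (m + 1), ∑ l : Fin (m + 1),
      if (i : ℕ) + (j : ℕ) = (l : ℕ) then ξ l ⁅takiffTrunc b m u i, b a⁆ else 0) = 0 := by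
    intro j a
    have h := congrArg (fun p => coeff p (m - (j : ℕ))) (congrFun hu a)
    simp only [Matrix.mulVecLin_apply, Matrix.mulVec, dotProduct, takiffPolyMatrix,
      Matrix.of_apply, Finset.sum_mul, finsetSum_coeff, Pi.zero_apply, coeff_zero] at h
    refine Eq.trans ?_ h
    rw [Finset.sum_comm, Finset.sum_comm (s := Finset.univ (α := ι))]
    refine Finset.sum_congr rfl fun l _ => ?_
    simp only [mul_assoc, coeff_C_mul, coeff_X_pow_mul']
    by_cases hjl : j ≤ l
    · have hl : (j : ℕ) ≤ l := hjl
      rw [Finset.sum_eq_single ⟨l - j, by omega⟩]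
      · rw [if_pos (Nat.sub_add_cancel hl)]
        simp only [takiffTrunc, LinearMap.coe_mk, AddHom.coe_mk, sum_lie, smul_lie, map_sum,
          map_smul, smul_eq_mul]
        refine Finset.sum_congr rfl fun c _ => ?_
        rw [if_pos (by omega), mul_comm, show m - (j : ℕ) - (m - (l : ℕ)) = l - j by omega]
      · exact fun i _ hi => if_neg fun h' => hi (Fin.ext (Nat.eq_sub_of_add_eq h'))
      · simp
    · have hl : (l : ℕ) < j := not_le.1 hjl
      rw [Finset.sum_eq_zero fun i _ => if_neg (by omega), Finset.sum_eq_zero fun c _ => ?_]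
      rw [if_neg (by omega), mul_zero]
  refine mem_takiffStab_assembleDual.2 fun j y => ?_
  let g : Dual k L := ∑ i : Fin (m + 1), ∑ l : Fin (m + 1), if (i : ℕ) + (j : ℕ) = (l : ℕ) then
    (ξ l).comp (LieAlgebra.ad k L (takiffTrunc b m u i)) else 0
  have hg : ∀ y, g y = ∑ i : Fin (m + 1), ∑ l : Fin (m + 1),
      if (i : ℕ) + (j : ℕ) = (l : ℕ) then ξ l ⁅takiffTrunc b m u i, y⁆ else 0 := by
    intro y
    simp only [g, LinearMap.sum_apply]
    refine Finset.sum_congr rfl fun i _ => Finset.sum_congr rfl fun l _ => ?_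
    split_ifs <;> rfl
  have hg0 : g = 0 := b.ext fun a => (hg (b a)).trans (hb j a)
  rw [← hg, hg0, LinearMap.zero_apply]

/-- The kernel of `takiffPolyMatrix b ξ` over `k[X]` has rank at least the index of `L`. -/
theorem lieIndex_le_finrank_ker_takiffPolyMatrix [Infinite k] (b : Basis ι k L)
    (ξ : Fin (m + 1) → Dual k L) :
    lieIndex k L ≤ finrank k[X] (LinearMap.ker (takiffPolyMatrix b ξ).mulVecLin) := by
  obtain ⟨t, ht⟩ := exists_finrank_ker_map_eval_le (takiffPolyMatrix b ξ)
  refine le_trans ?_ ht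
  refine (lieIndex_le_finrank_coadStab (∑ l : Fin (m + 1), t ^ (m - (l : ℕ)) • ξ l)).trans ?_
  have : FiniteDimensional k L := b.finiteDimensional_of_finite
  rw [← LinearEquiv.finrank_map_eq b.equivFun]
  refine Submodule.finrank_mono ?_
  rintro _ ⟨x, hx, rfl⟩
  rw [LinearMap.mem_ker]
  ext a
  have h := hx (b a)
  rw [← b.sum_repr x] at h
  simp only [sum_lie, smul_lie, map_sum, map_smul, smul_eq_mul, LinearMap.sum_apply,
    LinearMap.smul_apply] at h
  simp only [Matrix.mulVecLin_apply, Matrix.mulVec, dotProduct, takiffPolyMatrix,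
      Matrix.of_apply, Matrix.map_apply, eval_finsetSum, eval_mul, eval_C, eval_pow, eval_X]
  simpa [mul_comm] using h

theorem finrank_coadStab_add_le_finrank_takiffStab [Infinite k] [FiniteDimensional k L]
    (ξ : Fin (m + 1) → Dual k L) :
    finrank k (coadStab k (ξ (Fin.last m))) + m * lieIndex k L ≤
      finrank k (takiffStab k m (assembleDual k m ξ)) := by
  let b := finBasis k L
  obtain ⟨e, he, c, f, hcf⟩ : ∃ e, lieIndex k L ≤ e ∧
      ∃ (c : Basis (Fin (finrank k L)) k[X] (Fin (finrank k L) → k[X]))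
        (f : Fin e ↪ Fin (finrank k L)), ∀ s, (takiffPolyMatrix b ξ).mulVecLin (c (f s)) = 0 :=
    ⟨_, lieIndex_le_finrank_ker_takiffPolyMatrix b ξ,
      (takiffPolyMatrix b ξ).mulVecLin.exists_basis_embedding_ker (Pi.basisFun k[X] _)⟩
  -- Combinations of the kernel basis with polynomial coefficients of degree `< m`.
  let Φ : (Fin e → degreeLT k m) →ₗ[k] (Fin (finrank k L) → k[X]) :=
    ∑ s, ((LinearMap.toSpanSingleton k[X] _ (c (f s))).restrictScalars k).comp
      ((degreeLT k m).subtype.comp (LinearMap.proj s))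
  have hΦ : ∀ p, Φ p = ∑ s, (p s : k[X]) • c (f s) := fun p => by simp [Φ]
  have hker : ∀ p, (takiffPolyMatrix b ξ).mulVecLin (Φ p) = 0 := fun p => by
    simp only [hΦ, map_sum, map_smul, hcf, smul_zero, Finset.sum_const_zero]
  let Ψ : (coadStab k (ξ (Fin.last m)) × (Fin e → degreeLT k m)) →ₗ[k]
      takiffStab k m (assembleDual k m ξ) :=
    LinearMap.codRestrict _
      (((LinearMap.single k (fun _ => L) (Fin.last m)).comp (Submodule.subtype _)).coprod
        ((takiffTrunc b m).comp Φ))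
      fun q => add_mem (single_last_mem_takiffStab q.1.2)
        (takiffTrunc_mem_takiffStab b ξ (hker q.2))
  have hinj : Function.Injective Ψ := by
    rw [← LinearMap.ker_eq_bot, LinearMap.ker_eq_bot']
    rintro ⟨v, p⟩ h
    have h' : Pi.single (Fin.last m) (v : L) + takiffTrunc b m (Φ p) = 0 :=
      congrArg Subtype.val h
    have hdvd : ∀ l, X ^ m ∣ Φ p l := by
      refine fun l => X_pow_dvd_iff.2 fun i hi => ?_
      have hi' := congrFun h' ⟨i, by omega⟩
      rw [Pi.add_apply, Pi.single_eq_of_ne (fun h => by simp [Fin.ext_iff] at h; omega),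
        zero_add] at hi'
      exact Fintype.linearIndependent_iff.1 b.linearIndependent _ hi' l
    have hp : p = 0 := by
      ext1 s
      have hs := c.dvd_repr_of_forall_dvd hdvd (f s)
      have hrepr : c.repr (Φ p) (f s) = p s := by
        simp [hΦ, Finsupp.single_apply]
      rw [hrepr] at hs
      exact Subtype.ext (eq_zero_of_dvd_of_degree_lt hs (by
        rw [degree_X_pow]; exact mem_degreeLT.1 (p s).2))
    subst hp
    have hv := congrFun h' (Fin.last m)
    simp only [map_zero, add_zero, Pi.single_eq_same, Pi.zero_apply] at hv
    exact Prod.ext (Subtype.ext hv) rfl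
  have hdim : finrank k (degreeLT k m) = m := by
    rw [(degreeLTEquiv k m).finrank_eq, finrank_fin_fun]
  have : FiniteDimensional k (degreeLT k m) := (degreeLTEquiv k m).symm.finiteDimensional
  have hle := LinearMap.finrank_le_finrank_of_injective hinj
  rw [finrank_prod, finrank_pi_fintype] at hle
  simp only [hdim, Finset.sum_const, Finset.card_univ, Fintype.card_fin, smul_eq_mul] at hle
  nlinarith [Nat.mul_le_mul_left m he]

theorem takiffIndex_eq [Infinite k] [FiniteDimensional k L] :
    takiffIndex k L m = (m + 1) * lieIndex k L := by
  apply le_antisymm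
  · obtain ⟨η, hη⟩ := exists_finrank_coadStab_eq_lieIndex (k := k) (L := L)
    rw [← hη]
    exact le_trans (Nat.sInf_le ⟨assembleDual k m fun _ => η, rfl⟩)
      (finrank_takiffStab_le fun _ => η)
  · refine le_csInf ⟨_, 0, rfl⟩ ?_
    rintro _ ⟨η, rfl⟩
    obtain ⟨ξ, rfl⟩ := exists_assembleDual_eq η
    have h₁ := finrank_coadStab_add_le_finrank_takiffStab ξ
    have h₂ := lieIndex_le_finrank_coadStab (ξ (Fin.last m))
    linarith

end Takiff

/-- An element `ξ = (ξ_0,…,ξ_m) ∈ q⟨m⟩*` is regular iff its top component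
`ξ_m ∈ q*` is regular. -/
theorem takiff_regular_iff_top_regular (L : Type*) [Field k] [IsAlgClosed k]
    [CharZero k] [LieRing L] [LieAlgebra k L] [FiniteDimensional k L] (m : ℕ)
    (ξ : Fin (m + 1) → Module.Dual k L) :
    Module.finrank k (takiffStab k m (assembleDual k m ξ)) = takiffIndex k L m ↔
      Module.finrank k (coadStab k (ξ (Fin.last m))) = lieIndex k L := by
  have : Infinite k := IsAlgClosed.instInfinite
  rw [takiffIndex_eq]
  have h₁ := finrank_takiffStab_le ξ
  have h₂ := finrank_coadStab_add_le_finrank_takiffStab ξ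
  have h₃ := lieIndex_le_finrank_coadStab (ξ (Fin.last m))
  constructor
  · intro h
    linarith
  · intro h
    rw [h] at h₁ h₂
    linarith
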